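/- Let λ ∈ ℂ with |λ| > 1 and let L ⊆ ℂ be a measurable set that is invariant under the map z ↦ λz (i.e. λL = L), and suppose A := area(L ∩ {z : 1 ≤ |z| ≤ |λ|}) > 0. Then liminf_{r→∞} [logarea(L ∩ D(0,r) ∩ Δ)] / log r ≥ A/(|λ|² log |λ|) > 0. -/

import Mathlib

open MeasureTheory Filter Metric Set Topology ENNReal

/-- Logarithmic area of a subset of the plane. -/
noncomputable def logArea (A : Set ℂ) : ℝ≥0∞ :=
  ∫⁻ z in A, ENNReal.ofReal ((‖z‖ ^ 2)⁻¹)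

/-- The set Δ = {z : |z| ≥ 1}. -/
def Delta : Set ℂ := {z : ℂ | 1 ≤ ‖z‖}

/-- Chordal (spherical) distance on the Riemann sphere ℂ ∪ {∞}, with ∞ encoded as `none`. -/
noncomputable def chordalDist : Option ℂ → Option ℂ → ℝ
  | none, none => 0
  | none, some w => 2 / Real.sqrt (1 + ‖w‖ ^ 2)
  | some z, none => 2 / Real.sqrt (1 + ‖z‖ ^ 2)
  | some z, some w =>
      2 * ‖z - w‖ / (Real.sqrt (1 + ‖z‖ ^ 2) * Real.sqrt (1 + ‖w‖ ^ 2))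

/-- Locally uniform convergence on `U` of a sequence of ℂ-valued functions towards a
function with values in the Riemann sphere, with respect to the spherical metric. -/
def SphLocUnifConvOn (F : ℕ → ℂ → ℂ) (g : ℂ → Option ℂ) (U : Set ℂ) : Prop :=
  ∀ K : Set ℂ, K ⊆ U → IsCompact K → ∀ ε : ℝ, 0 < ε →
    ∀ᶠ n in atTop, ∀ z ∈ K, chordalDist (some (F n z)) (g z) < ε

/-- The Fatou set: points having a neighborhood on which every sequence of iterates has a
subsequence converging locally uniformly with respect to the spherical metric. -/
def fatouSet (f : ℂ → ℂ) : Set ℂ :=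
  {z | ∃ U ∈ 𝓝 z, ∀ φ : ℕ → ℕ, StrictMono φ →
    ∃ ψ : ℕ → ℕ, StrictMono ψ ∧ ∃ g : ℂ → Option ℂ,
      SphLocUnifConvOn (fun n => f^[φ (ψ n)]) g U}

/-- The Julia set. -/
def juliaSet (f : ℂ → ℂ) : Set ℂ := (fatouSet f)ᶜ

/-- The escaping set. -/
def escapingSet (f : ℂ → ℂ) : Set ℂ :=
  {z | Tendsto (fun n => ‖f^[n] z‖) atTop atTop}

/-- The Fatou set has no multiply connected component. -/
def NoMultiplyConnectedFatouComponent (f : ℂ → ℂ) : Prop :=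
  ∀ z ∈ fatouSet f, SimplyConnectedSpace (connectedComponentIn (fatouSet f) z)

/-- Maximum modulus M(r,f). -/
noncomputable def maxMod (f : ℂ → ℂ) (r : ℝ) : ℝ :=
  sSup ((fun z => ‖f z‖) '' {z : ℂ | ‖z‖ = r})

/-- The order ρ(f) of an entire function, as an extended real number. -/
noncomputable def entireOrder (f : ℂ → ℂ) : EReal :=
  limsup (fun r : ℝ => ((Real.log (Real.log (maxMod f r)) / Real.log r : ℝ) : EReal)) atTop

/-- The fast escaping set A(f). -/
def fastEscapingSet (f : ℂ → ℂ) : Set ℂ :=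
  {z | ∃ R : ℝ, 0 < R ∧ (∀ r : ℝ, R ≤ r → r < maxMod f r) ∧
    ∃ L : ℕ, ∀ n : ℕ, L < n → (maxMod f)^[n - L] R ≤ ‖f^[n] z‖}

/-- `f` is a transcendental entire function. -/
def TranscendentalEntire (f : ℂ → ℂ) : Prop :=
  Differentiable ℂ f ∧ ¬ ∃ p : Polynomial ℂ, ∀ z, f z = p.eval z

/-- Order of vanishing of `g` at `z` (the least `k` with nonzero `k`-th derivative). -/
noncomputable def vanishingOrder (g : ℂ → ℂ) (z : ℂ) : ℕ :=
  sInf {k : ℕ | iteratedDeriv k g z ≠ 0}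

/-- n(r,a): the number of solutions of f(z) = a with |z| ≤ r, counted with multiplicity. -/
noncomputable def nCount (f : ℂ → ℂ) (a : ℂ) (r : ℝ) : ℕ :=
  ∑ᶠ z ∈ {z : ℂ | ‖z‖ ≤ r ∧ f z = a}, vanishingOrder (fun w => f w - a) z

/-- n(r) = max over a of n(r,a). -/
noncomputable def nMax (f : ℂ → ℂ) (r : ℝ) : ℕ := ⨆ a : ℂ, nCount f a r

/-- Critical values of `f`. -/
def criticalValues (f : ℂ → ℂ) : Set ℂ := {w | ∃ z, deriv f z = 0 ∧ f z = w}

/-- Finite asymptotic values of `f`. -/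
def asymptoticValues (f : ℂ → ℂ) : Set ℂ :=
  {w | ∃ γ : ℝ → ℂ, Continuous γ ∧ Tendsto (fun t => ‖γ t‖) atTop atTop ∧
    Tendsto (fun t => f (γ t)) atTop (𝓝 w)}

/-- The Eremenko–Lyubich class B. -/
def ELClass (f : ℂ → ℂ) : Prop :=
  TranscendentalEntire f ∧ Bornology.IsBounded (criticalValues f ∪ asymptoticValues f)

/-- Semihyperbolic polynomial. -/
def SemiHyperbolic (p : Polynomial ℂ) : Prop :=
  ∃ ε : ℝ, 0 < ε ∧ ∃ N : ℕ, ∀ z ∈ juliaSet (fun w => p.eval w), ∀ n : ℕ, 1 ≤ n →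
    ∀ V : Set ℂ, (∃ u ∈ (fun w => p.eval w)^[n] ⁻¹' ball z ε,
        V = connectedComponentIn ((fun w => p.eval w)^[n] ⁻¹' ball z ε) u) →
      ∀ w ∈ ball z ε,
        (∑ᶠ u ∈ {u : ℂ | u ∈ V ∧ (fun v => p.eval v)^[n] u = w},
          vanishingOrder (fun ζ => (fun v => p.eval v)^[n] ζ - w) u) ≤ N

theorem logArea_image_mul_left {a : ℂ} (ha : a ≠ 0) {X : Set ℂ} (hX : MeasurableSet X) :
    logArea ((fun z => a * z) '' X) = logArea X := by
  have hdet : (ContinuousLinearMap.mul ℝ ℂ a).det = ‖a‖ ^ 2 := by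
    have h : (ContinuousLinearMap.mul ℝ ℂ a).det = Algebra.norm ℝ a := by
      rw [Algebra.norm_apply]; rfl
    rw [h, Algebra.norm_complex_eq]
    exact Complex.normSq_eq_norm_sq a
  have hna : 0 < ‖a‖ := norm_pos_iff.mpr ha
  unfold logArea
  rw [lintegral_image_eq_lintegral_abs_det_fderiv_mul volume hX (f := fun z => a * z)
    (f' := fun _ => ContinuousLinearMap.mul ℝ ℂ a)
    (fun x _ => (ContinuousLinearMap.mul ℝ ℂ a).hasFDerivWithinAt)
    (mul_right_injective₀ ha).injOn]
  refine lintegral_congr fun z => ?_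
  rw [hdet, abs_of_nonneg (by positivity), ← ENNReal.ofReal_mul (by positivity), norm_mul, mul_pow,
    mul_inv, mul_inv_cancel_left₀ (by positivity)]

theorem logArea_mono {X Y : Set ℂ} (h : X ⊆ Y) : logArea X ≤ logArea Y :=
  lintegral_mono_set h

theorem measurableSet_Delta : MeasurableSet Delta :=
  measurableSet_le measurable_const measurable_norm

/-- Each disk whose radius is a power of the multiplier contains that many copies of the
fundamental annulus. -/
theorem logArea_inter_ball_pow {a : ℂ} (ha : 1 < ‖a‖) {L : Set ℂ} (hL : MeasurableSet L)
    (hinv : (fun z => a * z) '' L = L) (n : ℕ) :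
    logArea (L ∩ ball 0 (‖a‖ ^ n) ∩ Delta) = n * logArea (L ∩ ball 0 ‖a‖ ∩ Delta) := by
  have ha0 : a ≠ 0 := norm_pos_iff.mp (by linarith)
  have hna : 0 < ‖a‖ := by linarith
  induction n with
  | zero =>
    have h : L ∩ ball 0 (‖a‖ ^ 0) ∩ Delta = ∅ := by
      ext z
      simp [Delta]
    rw [h]
    simp [logArea]
  | succ n ih =>
    have hX : MeasurableSet (L ∩ ball 0 (‖a‖ ^ n) ∩ Delta) :=
      (hL.inter measurableSet_ball).inter measurableSet_Delta
    have hmem : ∀ z, a * z ∈ L ↔ z ∈ L := fun z => by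
      constructor
      · intro h
        rw [← hinv] at h
        obtain ⟨w, hw, hwz⟩ := h
        rwa [← mul_left_cancel₀ ha0 hwz]
      · intro h
        rw [← hinv]
        exact ⟨z, h, rfl⟩
    have hunion : L ∩ ball 0 (‖a‖ ^ (n + 1)) ∩ Delta =
        (L ∩ ball 0 ‖a‖ ∩ Delta) ∪ (fun z => a * z) '' (L ∩ ball 0 (‖a‖ ^ n) ∩ Delta) := by
      ext z
      constructor
      · rintro ⟨⟨hz, hzb⟩, hzD⟩
        by_cases hza : ‖z‖ < ‖a‖
        · exact Or.inl ⟨⟨hz, by simpa using hza⟩, hzD⟩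
        · refine Or.inr ⟨z / a, ⟨⟨(hmem _).1 (by rwa [mul_div_cancel₀ _ ha0]), ?_⟩, ?_⟩,
            mul_div_cancel₀ _ ha0⟩
          · rw [mem_ball_zero_iff, norm_div, div_lt_iff₀ hna, ← pow_succ]
            simpa using hzb
          · change 1 ≤ ‖z / a‖
            rw [norm_div, one_le_div hna]
            exact not_lt.mp hza
      · rintro (⟨⟨hz, hzb⟩, hzD⟩ | ⟨w, ⟨⟨hw, hwb⟩, hwD⟩, rfl⟩)
        · exact ⟨⟨hz, ball_subset_ball (le_self_pow₀ ha.le n.succ_ne_zero) hzb⟩, hzD⟩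
        · refine ⟨⟨(hmem w).2 hw, ?_⟩, ?_⟩
          · rw [mem_ball_zero_iff] at hwb ⊢
            rw [norm_mul, pow_succ']
            gcongr
          · change 1 ≤ ‖a * w‖
            rw [norm_mul]
            exact one_le_mul_of_one_le_of_one_le ha.le hwD
    have hdisj : Disjoint (L ∩ ball 0 ‖a‖ ∩ Delta)
        ((fun z => a * z) '' (L ∩ ball 0 (‖a‖ ^ n) ∩ Delta)) := by
      rw [Set.disjoint_left]
      rintro _ ⟨⟨-, hzb⟩, -⟩ ⟨w, ⟨-, hwD⟩, rfl⟩
      rw [mem_ball_zero_iff, norm_mul] at hzb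
      have : 1 ≤ ‖w‖ := hwD
      nlinarith
    have hY : MeasurableSet ((fun z => a * z) '' (L ∩ ball 0 (‖a‖ ^ n) ∩ Delta)) :=
      (Homeomorph.mulLeft₀ a ha0).measurableEmbedding.measurableSet_image.2 hX
    rw [hunion]
    conv_lhs => unfold logArea
    rw [lintegral_union hY hdisj]
    change logArea _ + logArea _ = _
    rw [logArea_image_mul_left ha0 hX, ih]
    push_cast
    ring

theorem logArea_inter_Delta_ne_top (L : Set ℂ) (r : ℝ) : logArea (L ∩ ball 0 r ∩ Delta) ≠ ⊤ := by
  have hsub : L ∩ ball 0 r ∩ Delta ⊆ ball 0 r ∩ Delta := fun z hz => ⟨hz.1.2, hz.2⟩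
  have h : logArea (ball 0 r ∩ Delta) ≤ volume (ball (0 : ℂ) r ∩ Delta) := by
    rw [← setLIntegral_one]
    refine setLIntegral_mono' (measurableSet_ball.inter measurableSet_Delta) fun z hz => ?_
    have hz1 : 1 ≤ ‖z‖ := hz.2
    exact ENNReal.ofReal_le_one.2 (inv_le_one_of_one_le₀ (one_le_pow₀ hz1))
  exact ne_top_of_le_ne_top (measure_ball_lt_top (x := (0 : ℂ)) (r := r)).ne
    ((logArea_mono hsub).trans (h.trans (measure_mono inter_subset_left)))

/-- On a bounded annulus logarithmic area controls area. -/
theorem volume_inter_annulus_le {R : ℝ} (hR : 0 < R) {L : Set ℂ} (hL : MeasurableSet L) :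
    (volume (L ∩ {z : ℂ | 1 ≤ ‖z‖ ∧ ‖z‖ ≤ R})).toReal / R ^ 2 ≤
      (logArea (L ∩ ball 0 R ∩ Delta)).toReal := by
  have hX : MeasurableSet (L ∩ ball 0 R ∩ Delta) :=
    (hL.inter measurableSet_ball).inter measurableSet_Delta
  have hvol : volume (L ∩ {z : ℂ | 1 ≤ ‖z‖ ∧ ‖z‖ ≤ R}) ≤ volume (L ∩ ball 0 R ∩ Delta) := by
    have hsub : L ∩ {z : ℂ | 1 ≤ ‖z‖ ∧ ‖z‖ ≤ R} ⊆ (L ∩ ball 0 R ∩ Delta) ∪ sphere 0 R := by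
      rintro z ⟨hz, hz1, hzR⟩
      rcases hzR.lt_or_eq with h | h
      · exact Or.inl ⟨⟨hz, by simpa using h⟩, hz1⟩
      · exact Or.inr (by simpa using h)
    calc _ ≤ _ := measure_mono hsub
      _ ≤ _ := measure_union_le _ _
      _ = _ := by rw [Measure.addHaar_sphere, add_zero]
  have hlog : ENNReal.ofReal ((R ^ 2)⁻¹) * volume (L ∩ ball 0 R ∩ Delta) ≤
      logArea (L ∩ ball 0 R ∩ Delta) := by
    rw [← setLIntegral_const]
    refine setLIntegral_mono' hX fun z hz => ENNReal.ofReal_le_ofReal ?_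
    have hz1 : 1 ≤ ‖z‖ := hz.2
    have hzR : ‖z‖ < R := by simpa using hz.1.2
    gcongr
  have h := ENNReal.toReal_mono (logArea_inter_Delta_ne_top L R)
    ((mul_le_mul_right hvol _).trans hlog)
  rwa [ENNReal.toReal_mul, ENNReal.toReal_ofReal (by positivity), mul_comm, ← div_eq_mul_inv] at h

theorem logArea_inter_ball_bounds {a : ℂ} (ha : 1 < ‖a‖) {L : Set ℂ} (hL : MeasurableSet L)
    (hinv : (fun z => a * z) '' L = L) {r : ℝ} (hr : 1 ≤ r) :
    (Real.log r / Real.log ‖a‖ - 1) * (logArea (L ∩ ball 0 ‖a‖ ∩ Delta)).toReal ≤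
        (logArea (L ∩ ball 0 r ∩ Delta)).toReal ∧
      (logArea (L ∩ ball 0 r ∩ Delta)).toReal ≤
        (Real.log r / Real.log ‖a‖ + 1) * (logArea (L ∩ ball 0 ‖a‖ ∩ Delta)).toReal := by
  have hna : 0 < ‖a‖ := by linarith
  have hlog : 0 < Real.log ‖a‖ := Real.log_pos ha
  have hr0 : 0 < r := by linarith
  set n := ⌊Real.log r / Real.log ‖a‖⌋₊ with hn
  have hn1 : (n : ℝ) ≤ Real.log r / Real.log ‖a‖ :=
    Nat.floor_le (div_nonneg (Real.log_nonneg hr) hlog.le)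
  have hn2 : Real.log r / Real.log ‖a‖ < n + 1 := Nat.lt_floor_add_one _
  have hpow1 : ‖a‖ ^ n ≤ r := by
    rw [← Real.log_le_log_iff (by positivity) hr0, Real.log_pow]
    exact (le_div_iff₀ hlog).1 hn1
  have hpow2 : r ≤ ‖a‖ ^ (n + 1) := by
    rw [← Real.log_le_log_iff hr0 (by positivity), Real.log_pow]
    push_cast
    exact ((div_lt_iff₀ hlog).1 hn2).le
  have hmono : ∀ {s t : ℝ}, s ≤ t → (logArea (L ∩ ball 0 s ∩ Delta)).toReal ≤
      (logArea (L ∩ ball 0 t ∩ Delta)).toReal := fun hst =>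
    ENNReal.toReal_mono (logArea_inter_Delta_ne_top L _)
      (logArea_mono (inter_subset_inter_left _ (inter_subset_inter_right _ (ball_subset_ball hst))))
  have h1 := hmono hpow1
  have h2 := hmono hpow2
  rw [logArea_inter_ball_pow ha hL hinv, ENNReal.toReal_mul, ENNReal.toReal_natCast] at h1 h2
  push_cast at h2
  have hB : 0 ≤ (logArea (L ∩ ball 0 ‖a‖ ∩ Delta)).toReal := ENNReal.toReal_nonneg
  constructor
  · exact (mul_le_mul_of_nonneg_right (by linarith) hB).trans h1
  · exact h2.trans (mul_le_mul_of_nonneg_right (by linarith) hB)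

theorem tendsto_logArea_div_log {a : ℂ} (ha : 1 < ‖a‖) {L : Set ℂ} (hL : MeasurableSet L)
    (hinv : (fun z => a * z) '' L = L) :
    Tendsto (fun r : ℝ => (logArea (L ∩ ball 0 r ∩ Delta)).toReal / Real.log r) atTop
      (𝓝 ((logArea (L ∩ ball 0 ‖a‖ ∩ Delta)).toReal / Real.log ‖a‖)) := by
  have hlog : 0 < Real.log ‖a‖ := Real.log_pos ha
  set B := (logArea (L ∩ ball 0 ‖a‖ ∩ Delta)).toReal with hB
  have h0 : Tendsto (fun r : ℝ => B / Real.log r) atTop (𝓝 0) :=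
    Real.tendsto_log_atTop.const_div_atTop B
  have hlow : Tendsto (fun r : ℝ => B / Real.log ‖a‖ - B / Real.log r) atTop
      (𝓝 (B / Real.log ‖a‖)) := by
    simpa using h0.const_sub (B / Real.log ‖a‖)
  have hup : Tendsto (fun r : ℝ => B / Real.log ‖a‖ + B / Real.log r) atTop
      (𝓝 (B / Real.log ‖a‖)) := by
    simpa using h0.const_add (B / Real.log ‖a‖)
  refine tendsto_of_tendsto_of_tendsto_of_le_of_le' hlow hup ?_ ?_ <;>
    filter_upwards [eventually_gt_atTop 1] with r hr
  all_goals
    have hlr : 0 < Real.log r := Real.log_pos hr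
    obtain ⟨h1, h2⟩ := logArea_inter_ball_bounds ha hL hinv hr.le
  · rw [le_div_iff₀ hlr]
    refine le_of_eq_of_le ?_ h1
    rw [← hB]
    field_simp
  · rw [div_le_iff₀ hlr]
    refine h2.trans_eq ?_
    rw [← hB]
    field_simp

theorem liminf_logarea_of_invariant_set
    (lam : ℂ) (hlam : 1 < ‖lam‖) (L : Set ℂ) (hL : MeasurableSet L)
    (hinv : (fun z => lam * z) '' L = L)
    (A : ℝ) (hA : A = (volume (L ∩ {z : ℂ | 1 ≤ ‖z‖ ∧ ‖z‖ ≤ ‖lam‖})).toReal)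
    (hApos : 0 < A) :
    A / (‖lam‖ ^ 2 * Real.log ‖lam‖) ≤
        liminf (fun r : ℝ =>
          (logArea (L ∩ ball (0 : ℂ) r ∩ Delta)).toReal / Real.log r) atTop ∧
      0 < A / (‖lam‖ ^ 2 * Real.log ‖lam‖) := by
  have hlog : 0 < Real.log ‖lam‖ := Real.log_pos hlam
  have hna : 0 < ‖lam‖ := by linarith
  refine ⟨?_, by positivity⟩
  rw [(tendsto_logArea_div_log hlam hL hinv).liminf_eq, ← div_div, hA]
  exact div_le_div_of_nonneg_right (volume_inter_annulus_le hna hL) hlog.le
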